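/- arXiv:2312.14019 — 3 statements merged into one kernel-verified Lean document; each statement's English description precedes it below -/
import Mathlib

section
/- Let {e_α}_{α∈I} be a finite family in M_d(ℂ) with Σ_α e_α e_α† = 1_d, hermitian-closed in the sense that there is an involutive bijection σ : I → I with e_{σ(α)} = e_α† for all α; set Ω_A := Σ_α e_α ⊗ e_α†. Let B ⊆ M_d(ℂ) be a hermitian-closed unital subalgebra, Ω_B := ∫_{U(B)} V ⊗ V† dV, and let P_{B'} denote the orthogonal projection of M_d(ℂ) onto the commutant B' with respect to the Frobenius inner product. Then 1 − (1/d)·Tr(S · Ω_A · Ω_B) = 1 − (1/d) Σ_{α∈I} ‖P_{B'}(e_α)‖₂². -/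
open MeasureTheory Matrix Kronecker

noncomputable section

instance matMeasurableSpace (n : Type*) [Fintype n] : MeasurableSpace (Matrix n n ℂ) :=
  show MeasurableSpace (n → n → ℂ) from inferInstance

/-- Squared Frobenius (Hilbert-Schmidt) norm `‖X‖₂² = Tr(X† X)`. -/
def hs2 {n : Type*} [Fintype n] (X : Matrix n n ℂ) : ℝ := (Matrix.trace (Xᴴ * X)).re

/-- Mutual Averaged Non-commutativity: `(1/(2d)) ∫∫ ‖UV - VU‖₂² dμ(U) dν(V)`,
where `μ`, `ν` are meant to be the normalized Haar measures of the unitary groups of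
the two algebras (imposed by the `IsHaar` hypotheses in the theorems below). -/
def MAN {n : Type*} [Fintype n] (μ ν : Measure (Matrix n n ℂ)) : ℝ :=
  (1 / (2 * (Fintype.card n : ℝ))) * ∫ U, ∫ V, hs2 (U * V - V * U) ∂ν ∂μ

/-- `μ` is the normalized Haar probability measure of the compact unitary group
`U(A) = {U ∈ A : U†U = UU† = 1}` of the star-subalgebra `A`, viewed as a measure on
matrix space concentrated on `U(A)` and invariant under left translation by `U(A)`. -/
def IsHaar {n : Type*} [Fintype n] [DecidableEq n] (A : StarSubalgebra ℂ (Matrix n n ℂ))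
    (μ : Measure (Matrix n n ℂ)) : Prop :=
  IsProbabilityMeasure μ ∧
  μ {U | ¬ (U ∈ A ∧ U ∈ unitary (Matrix n n ℂ))} = 0 ∧
  ∀ U ∈ A, U ∈ unitary (Matrix n n ℂ) → μ.map (fun V => U * V) = μ

/-- The swap matrix `S ∈ M_{d²}(ℂ)`, `S((i,j),(k,l)) = δ_{i,l} δ_{j,k}`. -/
def swapMat (d : ℕ) : Matrix (Fin d × Fin d) (Fin d × Fin d) ℂ :=
  Matrix.of fun p q => if p.1 = q.2 ∧ p.2 = q.1 then 1 else 0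

/-- `Ω := ∫ U ⊗ U† dμ(U)` (entrywise integral, Kronecker product). -/
def Omega {d : ℕ} (μ : Measure (Matrix (Fin d) (Fin d) ℂ)) :
    Matrix (Fin d × Fin d) (Fin d × Fin d) ℂ :=
  Matrix.of fun p q => ∫ U, (U ⊗ₖ Uᴴ) p q ∂μ

/-- A matrix commuting with the unitaries of a star-subalgebra commutes with the whole algebra. -/
lemma commute_of_commute_unitary {n : Type*} [Fintype n] [DecidableEq n]
    (B : StarSubalgebra ℂ (Matrix n n ℂ)) (M : Matrix n n ℂ)
    (h : ∀ U ∈ B, U ∈ unitary (Matrix n n ℂ) → M * U = U * M) :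
    ∀ Y ∈ B, M * Y = Y * M := by
  open scoped Matrix.Norms.L2Operator in
  let : CStarAlgebra (Matrix n n ℂ) := {}
  have : IsClosed (B : Set (Matrix n n ℂ)) :=
    Submodule.closed_of_finiteDimensional (Subalgebra.toSubmodule B.toSubalgebra)
  let : CStarAlgebra B := StarSubalgebra.cstarAlgebra B
  intro Y hY
  have hspan : (⟨Y, hY⟩ : B) ∈ Submodule.span ℂ (unitary B : Set B) := by
    rw [CStarAlgebra.span_unitary]; trivial
  suffices ∀ Z : B, Z ∈ Submodule.span ℂ (unitary B : Set B) → M * (Z : Matrix n n ℂ) = Z * M from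
    this ⟨Y, hY⟩ hspan
  intro Z hZ
  induction hZ using Submodule.span_induction with
  | mem U hU =>
    refine h U U.2 ⟨?_, ?_⟩
    · exact congrArg Subtype.val hU.1
    · exact congrArg Subtype.val hU.2
  | zero => simp
  | add x y _ _ hx hy => simp [mul_add, add_mul, hx, hy]
  | smul c x _ hx => simp [hx]

section

variable {d : ℕ} {B : StarSubalgebra ℂ (Matrix (Fin d) (Fin d) ℂ)}
  {ν : Measure (Matrix (Fin d) (Fin d) ℂ)}

lemma IsHaar.ae_mem (hν : IsHaar B ν) :
    ∀ᵐ V ∂ν, V ∈ B ∧ V ∈ unitary (Matrix (Fin d) (Fin d) ℂ) := hν.2.1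

lemma measurable_entry (i j : Fin d) :
    Measurable fun V : Matrix (Fin d) (Fin d) ℂ => V i j :=
  (measurable_pi_apply j).comp
    (measurable_pi_apply (X := fun _ : Fin d => Fin d → ℂ) i)

lemma IsHaar.integrable_entry_mul_star (hν : IsHaar B ν) (i k j l : Fin d) :
    Integrable (fun V : Matrix (Fin d) (Fin d) ℂ => V i k * star (V j l)) ν := by
  have := hν.1
  refine Integrable.of_bound ((measurable_entry i k).mul
    (continuous_star.measurable.comp (measurable_entry j l))).aestronglyMeasurable 1 ?_
  filter_upwards [hν.ae_mem] with V hV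
  rw [norm_mul, norm_star]
  exact mul_le_one₀ (entry_norm_bound_of_unitary hV.2 _ _) (norm_nonneg _)
    (entry_norm_bound_of_unitary hV.2 _ _)

/-- The average `∫ V X V† dν(V)`, taken entrywise. -/
def twirl (ν : Measure (Matrix (Fin d) (Fin d) ℂ)) (X : Matrix (Fin d) (Fin d) ℂ) :
    Matrix (Fin d) (Fin d) ℂ :=
  Matrix.of fun i j => ∫ V, (V * X * Vᴴ) i j ∂ν

lemma conj_apply (V X : Matrix (Fin d) (Fin d) ℂ) (i j : Fin d) :
    (V * X * Vᴴ) i j = ∑ l, ∑ k, X k l * (V i k * star (V j l)) := by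
  simp only [Matrix.mul_apply, Matrix.conjTranspose_apply, Finset.sum_mul]
  refine Finset.sum_congr rfl fun l _ => Finset.sum_congr rfl fun k _ => ?_
  ring

lemma IsHaar.integrable_conj_apply (hν : IsHaar B ν) (X : Matrix (Fin d) (Fin d) ℂ)
    (i j : Fin d) : Integrable (fun V => (V * X * Vᴴ) i j) ν := by
  simp only [conj_apply]
  exact integrable_finsetSum _ fun l _ => integrable_finsetSum _ fun k _ =>
    (hν.integrable_entry_mul_star i k j l).const_mul _

lemma twirl_apply (hν : IsHaar B ν) (X : Matrix (Fin d) (Fin d) ℂ) (i j : Fin d) :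
    twirl ν X i j = ∑ l, ∑ k, X k l * ∫ V, V i k * star (V j l) ∂ν := by
  simp only [twirl, Matrix.of_apply, conj_apply]
  rw [integral_finsetSum _ fun l _ => integrable_finsetSum _ fun k _ =>
    (hν.integrable_entry_mul_star i k j l).const_mul _]
  refine Finset.sum_congr rfl fun l _ => ?_
  rw [integral_finsetSum _ fun k _ => (hν.integrable_entry_mul_star i k j l).const_mul _]
  simp only [integral_const_mul]

lemma trace_mul_twirl (hν : IsHaar B ν) (Y X : Matrix (Fin d) (Fin d) ℂ) :
    trace (Y * twirl ν X) = ∫ V, trace (Y * (V * X * Vᴴ)) ∂ν := by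
  have hint := hν.integrable_conj_apply X
  simp only [trace, diag_apply, Matrix.mul_apply (M := Y)]
  rw [integral_finsetSum _ fun i _ => integrable_finsetSum _ fun k _ =>
    (hint k i).const_mul (Y i k)]
  refine Finset.sum_congr rfl fun i _ => ?_
  rw [integral_finsetSum _ fun k _ => (hint k i).const_mul (Y i k)]
  simp only [integral_const_mul, twirl, Matrix.of_apply]

lemma measurable_trace_mul_conj (Y X : Matrix (Fin d) (Fin d) ℂ) :
    Measurable fun V : Matrix (Fin d) (Fin d) ℂ => trace (Y * (V * X * Vᴴ)) := by
  simp only [trace, diag_apply, Matrix.mul_apply (M := Y), conj_apply]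
  refine Finset.measurable_fun_sum _ fun i _ => Finset.measurable_fun_sum _ fun k _ => ?_
  refine Measurable.const_mul (Finset.measurable_fun_sum _ fun l _ =>
    Finset.measurable_fun_sum _ fun m _ => ?_) _
  exact ((measurable_entry _ _).mul
    (continuous_star.measurable.comp (measurable_entry _ _))).const_mul _

lemma measurable_mul_left_matrix (U : Matrix (Fin d) (Fin d) ℂ) :
    Measurable fun V : Matrix (Fin d) (Fin d) ℂ => U * V := by
  refine measurable_pi_lambda _ fun i => measurable_pi_lambda _ fun j => ?_
  simp only [Matrix.mul_apply]
  exact Finset.measurable_fun_sum _ fun k _ => (measurable_entry k j).const_mul _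

lemma conj_twirl (hν : IsHaar B ν) (X : Matrix (Fin d) (Fin d) ℂ)
    {U : Matrix (Fin d) (Fin d) ℂ} (hUB : U ∈ B) (hU : U ∈ unitary (Matrix (Fin d) (Fin d) ℂ)) :
    U * twirl ν X * Uᴴ = twirl ν X := by
  refine Matrix.ext_iff_trace_mul_left.mpr fun Y => ?_
  calc trace (Y * (U * twirl ν X * Uᴴ))
      = trace ((Uᴴ * Y * U) * twirl ν X) := by
        rw [← Matrix.mul_assoc, Matrix.trace_mul_comm]; simp only [Matrix.mul_assoc]
    _ = ∫ V, trace ((Uᴴ * Y * U) * (V * X * Vᴴ)) ∂ν := trace_mul_twirl hν _ _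
    _ = ∫ V, trace (Y * ((U * V) * X * (U * V)ᴴ)) ∂ν := by
        refine integral_congr_ae (Filter.Eventually.of_forall fun V => ?_)
        simp only [Matrix.conjTranspose_mul, Matrix.mul_assoc]
        rw [Matrix.trace_mul_comm]
        simp only [Matrix.mul_assoc]
    _ = ∫ V, trace (Y * (V * X * Vᴴ)) ∂(ν.map fun V => U * V) :=
        (integral_map (measurable_mul_left_matrix U).aemeasurable
          (measurable_trace_mul_conj Y X).aestronglyMeasurable).symm
    _ = trace (Y * twirl ν X) := by rw [hν.2.2 U hUB hU, trace_mul_twirl hν]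

lemma twirl_commute (hν : IsHaar B ν) (X : Matrix (Fin d) (Fin d) ℂ) :
    ∀ Y ∈ B, twirl ν X * Y = Y * twirl ν X := by
  refine commute_of_commute_unitary B _ fun U hUB hU => ?_
  have h : Uᴴ * U = 1 := hU.1
  conv_lhs => rw [← conj_twirl hν X hUB hU]
  rw [Matrix.mul_assoc, h, Matrix.mul_one]

lemma trace_mul_twirl_of_commute (hν : IsHaar B ν) (X Y : Matrix (Fin d) (Fin d) ℂ)
    (hY : ∀ Z ∈ B, Y * Z = Z * Y) : trace (Y * twirl ν X) = trace (Y * X) := by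
  have := hν.1
  rw [trace_mul_twirl hν]
  have : ∀ᵐ V ∂ν, trace (Y * (V * X * Vᴴ)) = trace (Y * X) := by
    filter_upwards [hν.ae_mem] with V hV
    have h : Vᴴ * V = 1 := hV.2.1
    rw [← Matrix.mul_assoc, ← Matrix.mul_assoc, hY V hV.1, Matrix.trace_mul_comm,
      ← Matrix.mul_assoc, ← Matrix.mul_assoc, h, Matrix.one_mul]
  rw [integral_congr_ae this]
  simp

lemma conjTranspose_commute {Y : Matrix (Fin d) (Fin d) ℂ} (hY : ∀ Z ∈ B, Y * Z = Z * Y) :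
    ∀ Z ∈ B, Yᴴ * Z = Z * Yᴴ := by
  intro Z hZ
  have h := congrArg conjTranspose (hY (star Z) (star_mem hZ))
  simpa [Matrix.star_eq_conjTranspose] using h.symm

/-- Averaging over the unitary group is the orthogonal projection onto the commutant. -/
lemma projection_eq_twirl (hν : IsHaar B ν) {X Q : Matrix (Fin d) (Fin d) ℂ}
    (hQ : ∀ Y ∈ B, Q * Y = Y * Q)
    (horth : ∀ Y : Matrix (Fin d) (Fin d) ℂ, (∀ Z ∈ B, Y * Z = Z * Y) →
      trace (Yᴴ * (X - Q)) = 0) : Q = twirl ν X := by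
  have hD : ∀ Z ∈ B, (twirl ν X - Q) * Z = Z * (twirl ν X - Q) := fun Z hZ => by
    rw [sub_mul, mul_sub, twirl_commute hν X Z hZ, hQ Z hZ]
  have h0 : trace ((twirl ν X - Q)ᴴ * (twirl ν X - Q)) = 0 := by
    rw [← horth _ hD, mul_sub, mul_sub, trace_sub, trace_sub,
      trace_mul_twirl_of_commute hν X _ (conjTranspose_commute hD)]
  open scoped ComplexOrder in
  exact (sub_eq_zero.mp (Matrix.trace_conjTranspose_mul_self_eq_zero_iff.mp h0)).symm

lemma ofReal_hs2 {n : Type*} [Fintype n] (X : Matrix n n ℂ) :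
    (hs2 X : ℂ) = trace (Xᴴ * X) := by
  refine Complex.conj_eq_iff_re.mp ?_
  rw [starRingEnd_apply, ← trace_conjTranspose, conjTranspose_mul, conjTranspose_conjTranspose]

lemma trace_swapMat_mul (M : Matrix (Fin d × Fin d) (Fin d × Fin d) ℂ) :
    trace (swapMat d * M) = ∑ i, ∑ j, M (i, j) (j, i) := by
  simp only [trace, diag_apply, Matrix.mul_apply, swapMat, Matrix.of_apply,
    Fintype.sum_prod_type, ite_mul, one_mul, zero_mul, ite_and]
  rw [Finset.sum_comm]
  simp

lemma trace_swapMat_mul_kronecker_mul_Omega (hν : IsHaar B ν) (A C : Matrix (Fin d) (Fin d) ℂ) :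
    trace (swapMat d * (A ⊗ₖ C) * Omega ν) = trace (A * twirl ν C) := by
  rw [Matrix.mul_assoc, trace_swapMat_mul]
  simp only [trace, diag_apply, Matrix.mul_apply, Fintype.sum_prod_type, kroneckerMap_apply,
    Omega, Matrix.of_apply, twirl_apply hν, conjTranspose_apply, Finset.mul_sum]
  refine Finset.sum_congr rfl fun i _ => ?_
  rw [Finset.sum_comm]
  refine Finset.sum_congr rfl fun k _ => ?_
  rw [Finset.sum_comm]
  refine Finset.sum_congr rfl fun l _ => Finset.sum_congr rfl fun j _ => ?_
  ring

end

/-- `1 - (1/d) Tr(S Ω_A Ω_B) = 1 - (1/d) Σ_α ‖P_{B'}(e_α)‖₂²`, where `P_{B'}` is the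
Frobenius-orthogonal projection onto the commutant of `B`. -/
theorem stmt_4 (d : ℕ) (hd : 0 < d) (I : Type*) [Fintype I]
    (e : I → Matrix (Fin d) (Fin d) ℂ)
    (he1 : ∑ α, e α * (e α)ᴴ = 1)
    (σ : I → I) (hσ : Function.Involutive σ) (hσe : ∀ α, e (σ α) = (e α)ᴴ)
    (B : StarSubalgebra ℂ (Matrix (Fin d) (Fin d) ℂ))
    (ν : Measure (Matrix (Fin d) (Fin d) ℂ)) (hν : IsHaar B ν)
    (P : Matrix (Fin d) (Fin d) ℂ →ₗ[ℂ] Matrix (Fin d) (Fin d) ℂ)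
    (hPmem : ∀ X, ∀ Y ∈ B, P X * Y = Y * P X)
    (hPorth : ∀ X (Y : Matrix (Fin d) (Fin d) ℂ), (∀ Z ∈ B, Y * Z = Z * Y) →
      Matrix.trace (Yᴴ * (X - P X)) = 0) :
    1 - (1 / (d : ℂ)) * Matrix.trace (swapMat d * (∑ α, e α ⊗ₖ (e α)ᴴ) * Omega ν)
      = ((1 - (1 / (d : ℝ)) * ∑ α, hs2 (P (e α)) : ℝ) : ℂ) := by
  have key : ∀ X : Matrix (Fin d) (Fin d) ℂ,
      trace (swapMat d * (Xᴴ ⊗ₖ X) * Omega ν) = (hs2 (P X) : ℂ) := fun X => by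
    have hP := hPorth X (P X) (hPmem X)
    rw [mul_sub, trace_sub, sub_eq_zero] at hP
    rw [trace_swapMat_mul_kronecker_mul_Omega hν,
      ← projection_eq_twirl hν (hPmem X) (hPorth X), ← Complex.conj_ofReal, ofReal_hs2, ← hP,
      starRingEnd_apply, ← trace_conjTranspose, conjTranspose_mul, conjTranspose_conjTranspose]
  have hsum : trace (swapMat d * (∑ α, e α ⊗ₖ (e α)ᴴ) * Omega ν) = ∑ α, (hs2 (P (e α)) : ℂ) := by
    rw [Matrix.mul_sum, Matrix.sum_mul, trace_sum, ← hσ.bijective.sum_comp]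
    refine Finset.sum_congr rfl fun α _ => ?_
    rw [hσe, conjTranspose_conjTranspose, key]
  rw [hsum]
  push_cast
  rfl
end
end

section
/- Let {v_i}_{i=1}^d and {w_j}_{j=1}^d be two orthonormal bases of ℂ^d, and let A and Ã be the maximal abelian subalgebras of M_d(ℂ) given by the ℂ-linear spans of the rank-one projections {v_i v_i†}_i and {w_j w_j†}_j respectively (these are hermitian-closed unital subalgebras). Then S(A : Ã) = (1/d) Σ_{i=1}^d (1 − Σ_{j=1}^d |⟨v_i, w_j⟩|⁴). -/
open MeasureTheory Matrix Kronecker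

noncomputable section

/-- The diagonal entries of `X` in the basis formed by the columns of `S`. -/
def diagCoeff {n : Type*} [Fintype n] (S X : Matrix n n ℂ) (i : n) : ℂ := (Sᴴ * X * S) i i

lemma hs2_eq_sum_sq {n : Type*} [Fintype n] (X : Matrix n n ℂ) :
    hs2 X = ∑ i, ∑ k, ‖X i k‖ ^ 2 := by
  simp only [hs2, Matrix.trace, Matrix.diag, Matrix.mul_apply, Matrix.conjTranspose_apply,
    Complex.re_sum]
  rw [Finset.sum_comm]
  refine Finset.sum_congr rfl fun i _ => Finset.sum_congr rfl fun k _ => ?_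
  rw [Complex.star_def, ← Complex.normSq_eq_conj_mul_self, Complex.ofReal_re,
    Complex.normSq_eq_norm_sq]

lemma hs2_conj {n : Type*} [Fintype n] [DecidableEq n] {S : Matrix n n ℂ} (hS : Sᴴ * S = 1)
    (X : Matrix n n ℂ) : hs2 (S * X * Sᴴ) = hs2 X := by
  have h : (S * X * Sᴴ)ᴴ * (S * X * Sᴴ) = S * (Xᴴ * X * Sᴴ) := by
    simp only [Matrix.conjTranspose_mul, Matrix.conjTranspose_conjTranspose, Matrix.mul_assoc]
    rw [← Matrix.mul_assoc Sᴴ S, hS, Matrix.one_mul]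
  rw [hs2, h, Matrix.trace_mul_comm, Matrix.mul_assoc, hS, Matrix.mul_one, hs2]

lemma conj_mul_conj {n : Type*} [Fintype n] [DecidableEq n] {S : Matrix n n ℂ}
    (hS : Sᴴ * S = 1) (X Y : Matrix n n ℂ) :
    S * X * Sᴴ * (S * Y * Sᴴ) = S * (X * Y) * Sᴴ := by
  simp only [Matrix.mul_assoc]
  rw [← Matrix.mul_assoc Sᴴ S, hS, Matrix.one_mul]

lemma conjTranspose_mul_conj_mul {n : Type*} [Fintype n] [DecidableEq n] {S : Matrix n n ℂ}
    (hS : Sᴴ * S = 1) (X : Matrix n n ℂ) : Sᴴ * (S * X * Sᴴ) * S = X := by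
  simp only [Matrix.mul_assoc]
  rw [hS, Matrix.mul_one, ← Matrix.mul_assoc, hS, Matrix.one_mul]

lemma diagCoeff_conj_diagonal {n : Type*} [Fintype n] [DecidableEq n] {S : Matrix n n ℂ}
    (hS : Sᴴ * S = 1) (c : n → ℂ) (i : n) : diagCoeff S (S * diagonal c * Sᴴ) i = c i := by
  rw [diagCoeff, conjTranspose_mul_conj_mul hS, Matrix.diagonal_apply_eq]

lemma measurable_diagCoeff {n : Type*} [Fintype n] (S : Matrix n n ℂ) (i : n) :
    Measurable fun X => diagCoeff S X i := by
  have hent (a b : n) : Measurable fun X : Matrix n n ℂ => X a b :=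
    (measurable_pi_apply b).comp (measurable_pi_apply a)
  simp only [diagCoeff, Matrix.mul_apply]
  exact Finset.measurable_sum _ fun a _ =>
    (Finset.measurable_sum _ fun b _ => (hent _ _).const_mul _).mul_const _

lemma measurable_matrix_mul_left {n : Type*} [Fintype n] (W : Matrix n n ℂ) :
    Measurable fun X : Matrix n n ℂ => W * X := by
  have hent (a b : n) : Measurable fun X : Matrix n n ℂ => X a b :=
    (measurable_pi_apply b).comp (measurable_pi_apply a)
  refine measurable_pi_lambda _ fun a => measurable_pi_lambda _ fun b => ?_
  simp only [Matrix.mul_apply]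
  exact Finset.measurable_sum _ fun c _ => (hent _ _).const_mul _

lemma hs2_commutator_conj_diagonal {n : Type*} [Fintype n] [DecidableEq n] {S : Matrix n n ℂ}
    (hS : Sᴴ * S = 1) (u : n → ℂ) (V : Matrix n n ℂ) :
    hs2 (S * diagonal u * Sᴴ * V - V * (S * diagonal u * Sᴴ)) =
      ∑ i, ∑ k, ‖u i - u k‖ ^ 2 * ‖(Sᴴ * V * S) i k‖ ^ 2 := by
  have hS' : S * Sᴴ = 1 := mul_eq_one_comm.mp hS
  obtain ⟨T, rfl⟩ : ∃ T, V = S * T * Sᴴ := ⟨Sᴴ * V * S, by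
    simp only [Matrix.mul_assoc]
    rw [hS', Matrix.mul_one, ← Matrix.mul_assoc, hS', Matrix.one_mul]⟩
  rw [conj_mul_conj hS, conj_mul_conj hS, ← Matrix.sub_mul, ← Matrix.mul_sub, hs2_conj hS,
    hs2_eq_sum_sq, conjTranspose_mul_conj_mul hS]
  refine Finset.sum_congr rfl fun i _ => Finset.sum_congr rfl fun k _ => ?_
  rw [Matrix.sub_apply, Matrix.diagonal_mul, Matrix.mul_diagonal, ← mul_pow, ← norm_mul]
  congr 2
  ring

lemma ofReal_norm_sum_mul_sq {n : Type*} [Fintype n] (c u : n → ℂ) :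
    ((‖∑ j, c j * u j‖ ^ 2 : ℝ) : ℂ) = ∑ i, ∑ k, star (c i) * c k * (star (u i) * u k) := by
  rw [← Complex.normSq_eq_norm_sq, Complex.normSq_eq_conj_mul_self, map_sum, Finset.sum_mul_sum]
  refine Finset.sum_congr rfl fun i _ => Finset.sum_congr rfl fun k _ => ?_
  simp only [map_mul, Complex.star_def]
  ring

section Haar

variable {n : Type*} [Fintype n] [DecidableEq n] {S : Matrix n n ℂ}
  {A : StarSubalgebra ℂ (Matrix n n ℂ)} {μ : Measure (Matrix n n ℂ)}

lemma norm_eq_one_of_conj_diagonal_mem_unitary (hS : Sᴴ * S = 1) {c : n → ℂ}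
    (h : S * diagonal c * Sᴴ ∈ unitary (Matrix n n ℂ)) (i : n) : ‖c i‖ = 1 := by
  have h1 := (Unitary.mem_iff.mp h).1
  rw [Matrix.star_eq_conjTranspose, Matrix.conjTranspose_mul, Matrix.conjTranspose_mul,
    Matrix.conjTranspose_conjTranspose, ← Matrix.mul_assoc S, conj_mul_conj hS,
    Matrix.diagonal_conjTranspose, Matrix.diagonal_mul_diagonal] at h1
  have h2 := diagCoeff_conj_diagonal hS (fun i => star c i * c i) i
  rw [h1, diagCoeff, Matrix.mul_one, hS, Matrix.one_apply_eq, Pi.star_apply, Complex.star_def,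
    ← Complex.normSq_eq_conj_mul_self, Complex.normSq_eq_norm_sq] at h2
  have h3 : ‖c i‖ ^ 2 = 1 := by exact_mod_cast h2.symm
  exact (pow_eq_one_iff_of_nonneg (norm_nonneg _) two_ne_zero).mp h3

lemma conj_diagonal_mem_unitary (hS : Sᴴ * S = 1) {c : n → ℂ} (hc : ∀ i, star (c i) * c i = 1) :
    S * diagonal c * Sᴴ ∈ unitary (Matrix n n ℂ) := by
  have hS' : S * Sᴴ = 1 := mul_eq_one_comm.mp hS
  have h : star (S * diagonal c * Sᴴ) * (S * diagonal c * Sᴴ) = 1 := by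
    rw [Matrix.star_eq_conjTranspose, Matrix.conjTranspose_mul, Matrix.conjTranspose_mul,
      Matrix.conjTranspose_conjTranspose, ← Matrix.mul_assoc S, conj_mul_conj hS,
      Matrix.diagonal_conjTranspose, Matrix.diagonal_mul_diagonal]
    simp only [Pi.star_apply, hc, Matrix.diagonal_one, Matrix.mul_one, hS']
  exact Unitary.mem_iff.mpr ⟨h, mul_eq_one_comm.mp h⟩

lemma IsHaar.ae_eq_conj_diagonal (hS : Sᴴ * S = 1)
    (hA : ∀ X, X ∈ A ↔ ∃ c, X = S * diagonal c * Sᴴ) (hμ : IsHaar A μ) :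
    ∀ᵐ U ∂μ, U = S * diagonal (diagCoeff S U) * Sᴴ ∧ ∀ i, ‖diagCoeff S U i‖ = 1 := by
  have h : ∀ᵐ U ∂μ, U ∈ A ∧ U ∈ unitary (Matrix n n ℂ) := hμ.2.1
  filter_upwards [h] with U hU
  obtain ⟨c, rfl⟩ := (hA U).mp hU.1
  have hc : diagCoeff S (S * diagonal c * Sᴴ) = c := funext (diagCoeff_conj_diagonal hS c)
  rw [hc]
  exact ⟨rfl, norm_eq_one_of_conj_diagonal_mem_unitary hS hU.2⟩

lemma IsHaar.integrable_star_diagCoeff_mul (hS : Sᴴ * S = 1)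
    (hA : ∀ X, X ∈ A ↔ ∃ c, X = S * diagonal c * Sᴴ) (hμ : IsHaar A μ) (i k : n) :
    Integrable (fun U => star (diagCoeff S U i) * diagCoeff S U k) μ := by
  have := hμ.1
  refine Integrable.of_bound (C := 1) ?_ ?_
  · exact ((Complex.continuous_conj.measurable.comp (measurable_diagCoeff S i)).mul
      (measurable_diagCoeff S k)).aestronglyMeasurable
  · filter_upwards [hμ.ae_eq_conj_diagonal hS hA] with U hU
    simp [hU.2]

/-- The coordinates of a Haar-random unitary of a maximal abelian algebra are orthonormal. -/
lemma IsHaar.integral_star_diagCoeff_mul (hS : Sᴴ * S = 1)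
    (hA : ∀ X, X ∈ A ↔ ∃ c, X = S * diagonal c * Sᴴ) (hμ : IsHaar A μ) (i k : n) :
    ∫ U, star (diagCoeff S U i) * diagCoeff S U k ∂μ = if i = k then 1 else 0 := by
  have := hμ.1
  split_ifs with hik
  · subst hik
    rw [integral_congr_ae (g := fun _ => (1 : ℂ))]
    · simp
    · filter_upwards [hμ.ae_eq_conj_diagonal hS hA] with U hU
      rw [Complex.star_def, ← Complex.normSq_eq_conj_mul_self, Complex.normSq_eq_norm_sq, hU.2]
      simp
  · set e : n → ℂ := fun j => if j = i then -1 else 1 with he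
    have hinv := hμ.2.2 (S * diagonal e * Sᴴ) ((hA _).mpr ⟨e, rfl⟩)
      (conj_diagonal_mem_unitary hS fun j => by by_cases h : j = i <;> simp [he, h])
    have hneg : ∫ U, star (diagCoeff S U i) * diagCoeff S U k ∂μ =
        ∫ U, -(star (diagCoeff S U i) * diagCoeff S U k) ∂μ := by
      conv_lhs => rw [← hinv]
      rw [integral_map (measurable_matrix_mul_left _).aemeasurable]
      · refine integral_congr_ae ?_
        filter_upwards [hμ.ae_eq_conj_diagonal hS hA] with U hU
        have hcoeff (j : n) : diagCoeff S (S * diagonal e * Sᴴ * U) j = e j * diagCoeff S U j := by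
          conv_lhs => rw [hU.1, conj_mul_conj hS, Matrix.diagonal_mul_diagonal,
            diagCoeff_conj_diagonal hS]
        simp only [hcoeff]
        simp [he, Ne.symm hik]
      · exact ((Complex.continuous_conj.measurable.comp (measurable_diagCoeff S i)).mul
          (measurable_diagCoeff S k)).aestronglyMeasurable
    rw [integral_neg] at hneg
    exact self_eq_neg.mp hneg

lemma IsHaar.integrable_norm_sum_diagCoeff_sq (hS : Sᴴ * S = 1)
    (hA : ∀ X, X ∈ A ↔ ∃ c, X = S * diagonal c * Sᴴ) (hμ : IsHaar A μ) (c : n → ℂ) :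
    Integrable (fun U => ‖∑ j, c j * diagCoeff S U j‖ ^ 2) μ := by
  have h : Integrable (fun U => ((‖∑ j, c j * diagCoeff S U j‖ ^ 2 : ℝ) : ℂ)) μ := by
    simp only [ofReal_norm_sum_mul_sq]
    exact integrable_finsetSum _ fun i _ => integrable_finsetSum _ fun k _ =>
      (hμ.integrable_star_diagCoeff_mul hS hA i k).const_mul _
  simpa only [RCLike.re_to_complex, Complex.ofReal_re] using h.re

lemma IsHaar.integral_norm_sum_diagCoeff_sq (hS : Sᴴ * S = 1)
    (hA : ∀ X, X ∈ A ↔ ∃ c, X = S * diagonal c * Sᴴ) (hμ : IsHaar A μ) (c : n → ℂ) :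
    ∫ U, ‖∑ j, c j * diagCoeff S U j‖ ^ 2 ∂μ = ∑ j, ‖c j‖ ^ 2 := by
  have hint (i k : n) := (hμ.integrable_star_diagCoeff_mul hS hA i k).const_mul (star (c i) * c k)
  apply Complex.ofReal_injective
  rw [← integral_complex_ofReal]
  simp only [ofReal_norm_sum_mul_sq]
  rw [integral_finsetSum _ fun i _ => integrable_finsetSum _ fun k _ => hint i k,
    Complex.ofReal_sum]
  refine Finset.sum_congr rfl fun i _ => ?_
  rw [integral_finsetSum _ fun k _ => hint i k]
  simp only [integral_const_mul, hμ.integral_star_diagCoeff_mul hS hA]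
  simp [← Complex.normSq_eq_conj_mul_self, Complex.normSq_eq_norm_sq]

lemma IsHaar.integral_norm_diagCoeff_sub_sq (hS : Sᴴ * S = 1)
    (hA : ∀ X, X ∈ A ↔ ∃ c, X = S * diagonal c * Sᴴ) (hμ : IsHaar A μ) (i k : n) :
    Integrable (fun U => ‖diagCoeff S U i - diagCoeff S U k‖ ^ 2) μ ∧
    ∫ U, ‖diagCoeff S U i - diagCoeff S U k‖ ^ 2 ∂μ = if i = k then 0 else 2 := by
  have hsum (u : n → ℂ) :
      ∑ j, (Pi.single i 1 - Pi.single k 1 : n → ℂ) j * u j = u i - u k := by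
    simp [sub_mul, Finset.sum_sub_distrib, Pi.single_apply]
  have h1 := hμ.integrable_norm_sum_diagCoeff_sq hS hA (Pi.single i 1 - Pi.single k 1)
  have h2 := hμ.integral_norm_sum_diagCoeff_sq hS hA (Pi.single i 1 - Pi.single k 1)
  simp only [hsum] at h1 h2
  refine ⟨h1, h2.trans ?_⟩
  split_ifs with hik
  · simp [hik]
  · have hj (j : n) : ‖(Pi.single i 1 - Pi.single k 1 : n → ℂ) j‖ ^ 2 =
        (if j = i then 1 else 0) + if j = k then (1 : ℝ) else 0 := by
      by_cases h : j = i
      · subst h; simp [hik]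
      · by_cases h' : j = k <;> simp [h, h', Ne.symm hik]
    simp only [hj, Finset.sum_add_distrib]
    norm_num

end Haar

lemma sum_norm_col_sq {n : Type*} [Fintype n] [DecidableEq n] {G : Matrix n n ℂ}
    (hG : Gᴴ * G = 1) (j : n) : ∑ i, ‖G i j‖ ^ 2 = 1 := by
  have h := congrFun (congrFun hG j) j
  simp only [Matrix.mul_apply, Matrix.conjTranspose_apply, Matrix.one_apply_eq, Complex.star_def,
    ← Complex.normSq_eq_conj_mul_self, Complex.normSq_eq_norm_sq] at h
  exact_mod_cast h

/-- The averaged squared commutator of two maximal abelian algebras whose eigenbases are the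
columns of the unitary matrices `S` and `R`. -/
lemma integral_hs2_commutator {n : Type*} [Fintype n] [DecidableEq n] {S R : Matrix n n ℂ}
    (hS : Sᴴ * S = 1) (hR : Rᴴ * R = 1) {A B : StarSubalgebra ℂ (Matrix n n ℂ)}
    (hA : ∀ X, X ∈ A ↔ ∃ c, X = S * diagonal c * Sᴴ)
    (hB : ∀ X, X ∈ B ↔ ∃ c, X = R * diagonal c * Rᴴ)
    {μ ν : Measure (Matrix n n ℂ)} (hμ : IsHaar A μ) (hν : IsHaar B ν) :
    ∫ U, ∫ V, hs2 (U * V - V * U) ∂ν ∂μ =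
      2 * ∑ i, (1 - ∑ j, ‖(Sᴴ * R) i j‖ ^ 4) := by
  set G := Sᴴ * R with hGdef
  have hS' : S * Sᴴ = 1 := mul_eq_one_comm.mp hS
  have hG : Gᴴ * G = 1 := by
    rw [hGdef, Matrix.conjTranspose_mul, Matrix.conjTranspose_conjTranspose, Matrix.mul_assoc,
      ← Matrix.mul_assoc S, hS', Matrix.one_mul, hR]
  have hGrow (i : n) : ∑ j, ‖G i j‖ ^ 2 = 1 := by
    have h := sum_norm_col_sq (G := Gᴴ) (by
      rw [Matrix.conjTranspose_conjTranspose]; exact mul_eq_one_comm.mp hG) i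
    simpa using h
  have hent : ∀ᵐ V ∂ν, ∀ i k, (Sᴴ * V * S) i k =
      ∑ j, (G i j * star (G k j)) * diagCoeff R V j := by
    filter_upwards [hν.ae_eq_conj_diagonal hR hB] with V hV i k
    have h : Sᴴ * V * S = G * diagonal (diagCoeff R V) * Gᴴ := by
      conv_lhs => rw [hV.1]
      simp only [hGdef, Matrix.conjTranspose_mul, Matrix.conjTranspose_conjTranspose,
        Matrix.mul_assoc]
    rw [h, Matrix.mul_apply]
    refine Finset.sum_congr rfl fun j _ => ?_
    rw [Matrix.mul_diagonal, Matrix.conjTranspose_apply]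
    ring
  have hinner : ∀ᵐ U ∂μ, ∫ V, hs2 (U * V - V * U) ∂ν =
      ∑ i, ∑ k, ‖diagCoeff S U i - diagCoeff S U k‖ ^ 2 *
        ∑ j, ‖G i j * star (G k j)‖ ^ 2 := by
    filter_upwards [hμ.ae_eq_conj_diagonal hS hA] with U hU
    have hae : ∀ᵐ V ∂ν, hs2 (U * V - V * U) =
        ∑ i, ∑ k, ‖diagCoeff S U i - diagCoeff S U k‖ ^ 2 *
          ‖∑ j, (G i j * star (G k j)) * diagCoeff R V j‖ ^ 2 := by
      filter_upwards [hent] with V hV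
      conv_lhs => rw [hU.1, hs2_commutator_conj_diagonal hS]
      simp only [hV]
    have hint (i k : n) := (hν.integrable_norm_sum_diagCoeff_sq hR hB
      fun j => G i j * star (G k j)).const_mul (‖diagCoeff S U i - diagCoeff S U k‖ ^ 2)
    rw [integral_congr_ae hae,
      integral_finsetSum _ fun i _ => integrable_finsetSum _ fun k _ => hint i k]
    refine Finset.sum_congr rfl fun i _ => ?_
    rw [integral_finsetSum _ fun k _ => hint i k]
    refine Finset.sum_congr rfl fun k _ => ?_
    rw [integral_const_mul, hν.integral_norm_sum_diagCoeff_sq hR hB]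
  have hint (i k : n) := (hμ.integral_norm_diagCoeff_sub_sq hS hA i k).1.mul_const
    (∑ j, ‖G i j * star (G k j)‖ ^ 2)
  rw [integral_congr_ae hinner,
    integral_finsetSum _ fun i _ => integrable_finsetSum _ fun k _ => hint i k, Finset.mul_sum]
  refine Finset.sum_congr rfl fun i _ => ?_
  rw [integral_finsetSum _ fun k _ => hint i k]
  simp only [integral_mul_const, (hμ.integral_norm_diagCoeff_sub_sq hS hA i _).2, norm_mul,
    norm_star, mul_pow]
  have hterm (k : n) : (if i = k then (0 : ℝ) else 2) * ∑ j, ‖G i j‖ ^ 2 * ‖G k j‖ ^ 2 =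
      2 * ∑ j, ‖G i j‖ ^ 2 * ‖G k j‖ ^ 2 -
        if i = k then 2 * ∑ j, ‖G i j‖ ^ 4 else 0 := by
    split_ifs with hik
    · subst hik
      simp only [← pow_add]
      ring
    · ring
  rw [Finset.sum_congr rfl fun k _ => hterm k, Finset.sum_sub_distrib, ← Finset.mul_sum,
    Finset.sum_comm]
  simp only [← Finset.mul_sum, sum_norm_col_sq hG, mul_one, hGrow, Finset.sum_ite_eq,
    Finset.mem_univ, if_true]
  ring

lemma conjTranspose_mul_self_of_orthonormal {n : Type*} [Fintype n] [DecidableEq n]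
    {v : n → n → ℂ} (hv : ∀ i j, (∑ k, star (v i k) * v j k) = if i = j then 1 else 0) :
    ((Matrix.of v)ᵀ)ᴴ * (Matrix.of v)ᵀ = 1 := by
  ext i j
  simpa [Matrix.mul_apply, Matrix.one_apply] using hv i j

lemma mem_iff_exists_conj_diagonal {n : Type*} [Fintype n] [DecidableEq n] {v : n → n → ℂ}
    {A : StarSubalgebra ℂ (Matrix n n ℂ)}
    (hA : (A : Set (Matrix n n ℂ)) =
      {X | ∃ c : n → ℂ, X = ∑ i, c i • Matrix.of (fun k l => v i k * star (v i l))})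
    (X : Matrix n n ℂ) :
    X ∈ A ↔ ∃ c, X = (Matrix.of v)ᵀ * diagonal c * ((Matrix.of v)ᵀ)ᴴ := by
  have hsum (c : n → ℂ) : ∑ i, c i • Matrix.of (fun k l => v i k * star (v i l)) =
      (Matrix.of v)ᵀ * diagonal c * ((Matrix.of v)ᵀ)ᴴ := by
    ext k l
    rw [Matrix.mul_apply, Matrix.sum_apply]
    refine Finset.sum_congr rfl fun i _ => ?_
    rw [Matrix.mul_diagonal]
    simp only [Matrix.smul_apply, Matrix.of_apply, Matrix.conjTranspose_apply,
      Matrix.transpose_apply, smul_eq_mul]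
    ring
  rw [← SetLike.mem_coe, hA, Set.mem_ofPred_eq]
  simp only [hsum]

/-- MAN of two maximal abelian algebras:
`S(A : Ã) = (1/d) Σ_i (1 - Σ_j |⟨v_i, w_j⟩|⁴)`. -/
theorem stmt_9 (d : ℕ) (hd : 0 < d) (v w : Fin d → Fin d → ℂ)
    (hv : ∀ i j, (∑ k, star (v i k) * v j k) = if i = j then 1 else 0)
    (hw : ∀ i j, (∑ k, star (w i k) * w j k) = if i = j then 1 else 0)
    (A At : StarSubalgebra ℂ (Matrix (Fin d) (Fin d) ℂ))
    (hA : (A : Set (Matrix (Fin d) (Fin d) ℂ)) =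
      {X | ∃ c : Fin d → ℂ, X = ∑ i, c i • Matrix.of (fun k l => v i k * star (v i l))})
    (hAt : (At : Set (Matrix (Fin d) (Fin d) ℂ)) =
      {X | ∃ c : Fin d → ℂ, X = ∑ j, c j • Matrix.of (fun k l => w j k * star (w j l))})
    (μ ν : Measure (Matrix (Fin d) (Fin d) ℂ))
    (hμ : IsHaar A μ) (hν : IsHaar At ν) :
    MAN μ ν = (1 / (d : ℝ)) * ∑ i, (1 - ∑ j, ‖∑ k, star (v i k) * w j k‖ ^ 4) := by
  have hG (i j : Fin d) : (((Matrix.of v)ᵀ)ᴴ * (Matrix.of w)ᵀ) i j =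
      ∑ k, star (v i k) * w j k := by
    simp [Matrix.mul_apply]
  rw [MAN, integral_hs2_commutator (conjTranspose_mul_self_of_orthonormal hv)
    (conjTranspose_mul_self_of_orthonormal hw) (mem_iff_exists_conj_diagonal hA)
    (mem_iff_exists_conj_diagonal hAt) hμ hν, Fintype.card_fin]
  simp only [hG]
  have hd' : (d : ℝ) ≠ 0 := by exact_mod_cast hd.ne'
  field_simp
end
end

section
/- Let d₁, d₂ ≥ 1, d := d₁d₂, and identify ℂ^d with matrices indexed by Fin d₁ × Fin d₂. Let A := {M ⊗ 1_{d₂} : M ∈ M_{d₁}(ℂ)} (Kronecker product with the identity), and let Π_1, …, Π_K ∈ M_d(ℂ) be hermitian projections (Π_i² = Π_i = Π_i†) that are pairwise orthogonal (Π_iΠ_j = 0 for i ≠ j) and satisfy Σ_i Π_i = 1_d; let B be the ℂ-linear span of {Π_i} (an abelian hermitian-closed unital subalgebra). Then S(A : B) = 1 − (1/(d·d₁)) Σ_{i=1}^K ‖Tr₁ Π_i‖₂², where the partial trace Tr₁ M ∈ M_{d₂}(ℂ) of M ∈ M_d(ℂ) is (Tr₁ M)(j, j') := Σ_{i ∈ Fin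 d₁} M((i,j),(i,j')). -/
open MeasureTheory Matrix Kronecker

noncomputable section

instance matBorelSpace (n : Type*) [Fintype n] : BorelSpace (Matrix n n ℂ) :=
  inferInstanceAs (BorelSpace (n → n → ℂ))

theorem isCompact_unitary_matrix (n : Type*) [Fintype n] [DecidableEq n] :
    IsCompact (unitary (Matrix n n ℂ) : Set (Matrix n n ℂ)) := by
  have hK : IsCompact (Set.univ.pi fun _ : n => Set.univ.pi fun _ : n =>
      Metric.closedBall (0 : ℂ) 1) :=
    isCompact_univ_pi fun _ => isCompact_univ_pi fun _ => isCompact_closedBall _ _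
  refine IsCompact.of_isClosed_subset hK ?_ ?_
  · have : (unitary (Matrix n n ℂ) : Set (Matrix n n ℂ)) =
        {U | Uᴴ * U = 1} ∩ {U | U * Uᴴ = 1} := by
      ext U
      simp [Unitary.mem_iff, star_eq_conjTranspose]
    rw [this]
    exact (isClosed_eq (by fun_prop) (by fun_prop)).inter
      (isClosed_eq (by fun_prop) (by fun_prop))
  · intro U hU i _ j _
    simpa using entry_norm_bound_of_unitary hU i j

section Haar

variable {n : Type*} [Fintype n] [DecidableEq n] {A : StarSubalgebra ℂ (Matrix n n ℂ)}
  {μ : Measure (Matrix n n ℂ)}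

theorem IsHaar.ae_mem_s11 (hμ : IsHaar A μ) : ∀ᵐ U ∂μ, U ∈ A ∧ U ∈ unitary (Matrix n n ℂ) :=
  ae_iff.2 hμ.2.1

theorem IsHaar.integrable (hμ : IsHaar A μ) {f : Matrix n n ℂ → ℝ} (hf : Continuous f) :
    Integrable f μ := by
  have := hμ.1
  obtain ⟨C, hC⟩ := (isCompact_unitary_matrix n).exists_bound_of_continuousOn hf.continuousOn
  refine Integrable.of_bound hf.measurable.aestronglyMeasurable C ?_
  filter_upwards [hμ.ae_mem_s11] with U hU using hC U hU.2

theorem IsHaar.integral_mul_left (hμ : IsHaar A μ) {f : Matrix n n ℂ → ℝ} (hf : Continuous f)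
    {W : Matrix n n ℂ} (hWA : W ∈ A) (hW : W ∈ unitary (Matrix n n ℂ)) :
    ∫ U, f (W * U) ∂μ = ∫ U, f U ∂μ := by
  have hm : Measurable fun U : Matrix n n ℂ => W * U :=
    (show Continuous fun U : Matrix n n ℂ => W * U by fun_prop).measurable
  conv_rhs => rw [← hμ.2.2 W hWA hW]
  rw [integral_map hm.aemeasurable hf.measurable.aestronglyMeasurable]

/-- If the average of `f` over finitely many left translates is constant on the unitary group,
then this constant is the Haar integral of `f`. -/
theorem IsHaar.integral_eq_of_sum_eq (hμ : IsHaar A μ) {f : Matrix n n ℂ → ℝ}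
    (hf : Continuous f) {ι : Type*} [Fintype ι] [Nonempty ι] (W : ι → Matrix n n ℂ)
    (hWA : ∀ k, W k ∈ A) (hW : ∀ k, W k ∈ unitary (Matrix n n ℂ)) (c : ℝ)
    (h : ∀ U ∈ A, U ∈ unitary (Matrix n n ℂ) → ∑ k, f (W k * U) = Fintype.card ι * c) :
    ∫ U, f U ∂μ = c := by
  have := hμ.1
  have hι : (Fintype.card ι : ℝ) ≠ 0 := by exact_mod_cast Fintype.card_ne_zero
  apply mul_left_cancel₀ hι
  calc (Fintype.card ι : ℝ) * ∫ U, f U ∂μ = ∑ k, ∫ U, f (W k * U) ∂μ := by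
        simp [hμ.integral_mul_left hf (hWA _) (hW _)]
    _ = ∫ U, ∑ k, f (W k * U) ∂μ := by
        rw [integral_finsetSum]
        exact fun k _ => hμ.integrable (hf.comp (by fun_prop))
    _ = ∫ U, (Fintype.card ι : ℝ) * c ∂μ :=
        integral_congr_ae (by filter_upwards [hμ.ae_mem_s11] with U hU using h U hU.1 hU.2)
    _ = Fintype.card ι * c := by simp

end Haar

theorem continuous_hs2 {n : Type*} [Fintype n] : Continuous (hs2 : Matrix n n ℂ → ℝ) := by
  unfold hs2
  fun_prop

theorem hs2_commutator_of_unitary {n : Type*} [Fintype n] [DecidableEq n] {U V : Matrix n n ℂ}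
    (hU : U ∈ unitary (Matrix n n ℂ)) (hV : V ∈ unitary (Matrix n n ℂ)) :
    hs2 (U * V - V * U) = 2 * Fintype.card n - 2 * (trace (Vᴴ * Uᴴ * V * U)).re := by
  have hU' : Uᴴ * U = 1 := Unitary.star_mul_self_of_mem hU
  have hV' : Vᴴ * V = 1 := Unitary.star_mul_self_of_mem hV
  have e : (U * V - V * U)ᴴ * (U * V - V * U) =
      Vᴴ * (Uᴴ * U) * V + Uᴴ * (Vᴴ * V) * U - Vᴴ * Uᴴ * V * U - (Vᴴ * Uᴴ * V * U)ᴴ := by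
    simp only [conjTranspose_sub, conjTranspose_mul, conjTranspose_conjTranspose]
    noncomm_ring
  rw [hs2, e, hU', hV', mul_one, mul_one, hU', hV', trace_sub, trace_sub, trace_add,
    trace_conjTranspose, trace_one]
  simp
  ring

theorem IsPrimitiveRoot.star_mul_self {K : ℕ} {ω : ℂ} (hω : IsPrimitiveRoot ω K) (hK : K ≠ 0) :
    star ω * ω = 1 := by
  simp [← Complex.normSq_eq_conj_mul_self, Complex.normSq_eq_norm_sq, hω.norm'_eq_one hK]

theorem sum_star_pow_mul_pow {K : ℕ} {ω : ℂ} (hω : IsPrimitiveRoot ω K) (a b : Fin K) :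
    ∑ t : Fin K, star ((ω ^ (a : ℕ)) ^ (t : ℕ)) * (ω ^ (b : ℕ)) ^ (t : ℕ) =
      if a = b then (K : ℂ) else 0 := by
  have hK : K ≠ 0 := fun h => by subst h; exact a.elim0
  have hs := hω.star_mul_self hK
  have ha : star (ω ^ (a : ℕ)) * ω ^ (a : ℕ) = 1 := by
    rw [star_pow, ← mul_pow, hs, one_pow]
  simp_rw [star_pow _ (_ : ℕ), ← mul_pow]
  split_ifs with h
  · subst h
    simp_rw [← mul_pow, hs]
    simp
  · rw [Fin.sum_univ_eq_sum_range (fun t => (star ω ^ (a : ℕ) * ω ^ (b : ℕ)) ^ t)]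
    rw [← star_pow]
    have hz : star (ω ^ (a : ℕ)) * ω ^ (b : ℕ) ≠ 1 := by
      intro h1
      apply h
      have : ω ^ (a : ℕ) = ω ^ (b : ℕ) := by
        linear_combination (-ω ^ (a : ℕ)) * h1 + ω ^ (b : ℕ) * ha
      exact Fin.ext (hω.pow_inj a.2 b.2 this)
    have hz1 : (star (ω ^ (a : ℕ)) * ω ^ (b : ℕ)) ^ K = 1 := by
      rw [mul_pow, ← star_pow, ← pow_mul, ← pow_mul, mul_comm, mul_comm (b : ℕ),
        pow_mul, mul_comm (a : ℕ), pow_mul, hω.pow_eq_one]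
      simp
    have := geom_sum_mul (star (ω ^ (a : ℕ)) * ω ^ (b : ℕ)) K
    rw [hz1, sub_self] at this
    exact (mul_eq_zero.1 this).resolve_right (sub_ne_zero.2 hz)

/-- Pinching by a projective resolution of the identity is an average of unitary conjugations. -/
theorem exists_unitary_sum_conj_eq {n : Type*} [Fintype n] [DecidableEq n] {K : ℕ}
    {P : Fin K → Matrix n n ℂ} (hherm : ∀ i, (P i)ᴴ = P i) (hidem : ∀ i, P i * P i = P i)
    (horth : ∀ i j, i ≠ j → P i * P j = 0) (hsum : ∑ i, P i = 1) :
    ∃ W : Fin K → Matrix n n ℂ, (∀ t, ∃ c : Fin K → ℂ, W t = ∑ i, c i • P i) ∧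
      (∀ t, W t ∈ unitary (Matrix n n ℂ)) ∧
      ∀ X, ∑ t, (W t)ᴴ * X * W t = (K : ℂ) • ∑ a, P a * X * P a := by
  rcases Nat.eq_zero_or_pos K with rfl | hK
  · exact ⟨fun _ => 1, fun t => t.elim0, fun t => t.elim0, by simp⟩
  have hω := Complex.isPrimitiveRoot_exp K hK.ne'
  set ω := Complex.exp (2 * Real.pi * Complex.I / K)
  have hs := hω.star_mul_self hK.ne'
  refine ⟨fun t => ∑ i : Fin K, (ω ^ (i : ℕ)) ^ (t : ℕ) • P i, fun t => ⟨_, rfl⟩,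
    fun t => ?_, fun X => ?_⟩
  · have h1 : star (∑ i : Fin K, (ω ^ (i : ℕ)) ^ (t : ℕ) • P i) *
        ∑ i : Fin K, (ω ^ (i : ℕ)) ^ (t : ℕ) • P i = 1 := by
      simp only [star_eq_conjTranspose, conjTranspose_sum, conjTranspose_smul, hherm,
        Finset.sum_mul_sum, smul_mul_smul_comm]
      rw [← hsum]
      refine Finset.sum_congr rfl fun i _ => ?_
      rw [Finset.sum_eq_single i (fun j _ hj => by simp [horth i j hj.symm]) (by simp), hidem,
        star_pow, star_pow, ← mul_pow, ← mul_pow, hs, one_pow, one_pow, one_smul]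
    exact Unitary.mem_iff.2 ⟨h1, mul_eq_one_comm.1 h1⟩
  · simp only [conjTranspose_sum, conjTranspose_smul, hherm, Finset.sum_mul, Finset.mul_sum,
      smul_mul_assoc, mul_smul_comm, Finset.smul_sum, smul_smul]
    rw [Finset.sum_comm]
    refine Finset.sum_congr rfl fun b _ => ?_
    rw [Finset.sum_comm]
    simp_rw [← Finset.sum_smul, mul_comm ((ω ^ (b : ℕ)) ^ _), sum_star_pow_mul_pow hω]
    simp [ite_smul]

/-- The partial trace over the first tensor factor. -/
def partialTraceLeft {l m : Type*} [Fintype l] (X : Matrix (l × m) (l × m) ℂ) : Matrix m m ℂ :=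
  Matrix.of fun j j' => ∑ a, X (a, j) (a, j')

theorem trace_mul_one_kronecker {l m : Type*} [Fintype l] [Fintype m] [DecidableEq l]
    (X : Matrix (l × m) (l × m) ℂ) (N : Matrix m m ℂ) :
    trace (X * ((1 : Matrix l l ℂ) ⊗ₖ N)) = trace (partialTraceLeft X * N) := by
  simp only [trace, diag_apply, mul_apply, Fintype.sum_prod_type, kroneckerMap_apply,
    one_apply, ite_mul, one_mul, zero_mul, mul_ite, mul_zero, partialTraceLeft, of_apply,
    Finset.sum_mul]
  rw [Finset.sum_comm]
  refine Finset.sum_congr rfl fun j _ => ?_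
  rw [Finset.sum_comm' (t' := Finset.univ) (s' := fun _ => Finset.univ) (by simp)]
  simp [Finset.sum_comm (s := (Finset.univ : Finset m))]

theorem conjTranspose_partialTraceLeft {l m : Type*} [Fintype l]
    (X : Matrix (l × m) (l × m) ℂ) :
    (partialTraceLeft X)ᴴ = partialTraceLeft Xᴴ := by
  ext j j'
  simp [partialTraceLeft]

/-- The completely depolarizing map on the first tensor factor is an average of conjugations by
unitaries of that factor. -/
theorem exists_unitary_sum_conj_eq_partialTraceLeft (d : ℕ) [NeZero d] (m : Type*) [Fintype m]
    [DecidableEq m] :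
    ∃ W : Fin d × Fin d → Matrix (Fin d × m) (Fin d × m) ℂ,
      (∀ k, ∃ M : Matrix (Fin d) (Fin d) ℂ, W k = M ⊗ₖ (1 : Matrix m m ℂ)) ∧
      (∀ k, W k ∈ unitary (Matrix (Fin d × m) (Fin d × m) ℂ)) ∧
      ∀ X, ∑ k, (W k)ᴴ * X * W k =
        (d : ℂ) • ((1 : Matrix (Fin d) (Fin d) ℂ) ⊗ₖ partialTraceLeft X) := by
  let E : Fin d → Matrix (Fin d × m) (Fin d × m) ℂ := fun i => single i i 1 ⊗ₖ 1
  obtain ⟨D, hD, hDu, hDX⟩ := exists_unitary_sum_conj_eq (P := E)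
    (fun i => by simp [E, conjTranspose_kronecker])
    (fun i => by simp [E, ← mul_kronecker_mul])
    (fun i j hij => by simp [E, ← mul_kronecker_mul, hij])
    (by
      ext ⟨i, j⟩ ⟨i', j'⟩
      by_cases h : j = j' <;> simp [E, Matrix.sum_apply, single_apply, one_apply, ite_and, h])
  let S : Fin d → Matrix (Fin d × m) (Fin d × m) ℂ := fun s =>
    (1 : Matrix (Fin d) (Fin d) ℂ).submatrix id (· + s) ⊗ₖ 1
  have hS (s : Fin d) : S s =
      (1 : Matrix (Fin d × m) (Fin d × m) ℂ).submatrix id (Prod.map (· + s) id) := by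
    ext ⟨i, j⟩ ⟨i', j'⟩
    by_cases h : j = j' <;> simp [S, one_apply, h]
  have hSX (s : Fin d) (Y) : (S s)ᴴ * Y * S s =
      Y.submatrix (Prod.map (· + s) id) (Prod.map (· + s) id) := by
    ext p q
    simp [hS, mul_apply, one_apply]
  have hSu (s : Fin d) : S s ∈ unitary (Matrix (Fin d × m) (Fin d × m) ℂ) := by
    have h : star (S s) * S s = 1 := by
      rw [← mul_one (star (S s)), star_eq_conjTranspose, hSX]
      exact submatrix_one _ ((add_left_injective s).prodMap Function.injective_id)
    exact Unitary.mem_iff.2 ⟨h, mul_eq_one_comm.1 h⟩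
  refine ⟨fun k => D k.2 * S k.1, fun k => ?_, fun k => mul_mem (hDu _) (hSu _), fun X => ?_⟩
  · obtain ⟨c, hc⟩ := hD k.2
    refine ⟨(∑ i, c i • single i i 1) * (1 : Matrix (Fin d) (Fin d) ℂ).submatrix id (· + k.1), ?_⟩
    have : D k.2 = (∑ i, c i • single i i 1) ⊗ₖ 1 := by
      rw [hc]
      ext ⟨i, j⟩ ⟨i', j'⟩
      simp [E, Matrix.sum_apply, Finset.sum_mul, single_apply]
    simp only [this, S]
    rw [← mul_kronecker_mul, mul_one]
  · have h (s : Fin d) : ∑ t, (D t * S s)ᴴ * X * (D t * S s) =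
        (d : ℂ) • (∑ a, E a * X * E a).submatrix (Prod.map (· + s) id) (Prod.map (· + s) id) := by
      have := hSX s ((d : ℂ) • ∑ a, E a * X * E a)
      rw [← hDX, Finset.mul_sum, Finset.sum_mul, hDX] at this
      simpa only [conjTranspose_mul, mul_assoc, submatrix_smul, Pi.smul_apply] using this
    rw [Fintype.sum_prod_type]
    simp only [h]
    rw [← Finset.smul_sum]
    congr 1
    have hE (a i i' : Fin d) (j j' : m) : (E a * X * E a) (i, j) (i', j') =
        if a = i then if a = i' then X (a, j) (a, j') else 0 else 0 := by
      simp only [E, mul_apply, Fintype.sum_prod_type, kroneckerMap_apply, single_apply, one_apply]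
      by_cases h1 : a = i <;> by_cases h2 : a = i' <;> simp [h1, h2, ite_and]
    ext ⟨i, j⟩ ⟨i', j'⟩
    simp only [Matrix.sum_apply, submatrix_apply, Prod.map_apply, id, hE, kroneckerMap_apply,
      one_apply, partialTraceLeft, of_apply]
    by_cases hi : i = i'
    · subst hi
      simpa using Equiv.sum_comp (Equiv.addLeft i) fun a => X (a, j) (a, j')
    · simp [hi]

theorem IsHaar.integral_hs2_commutator_of_span {n : Type*} [Fintype n] [DecidableEq n] {K : ℕ}
    [NeZero K] {P : Fin K → Matrix n n ℂ} (hherm : ∀ i, (P i)ᴴ = P i)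
    (hidem : ∀ i, P i * P i = P i) (horth : ∀ i j, i ≠ j → P i * P j = 0) (hsum : ∑ i, P i = 1)
    {B : StarSubalgebra ℂ (Matrix n n ℂ)} (hB : ∀ X, X ∈ B ↔ ∃ c : Fin K → ℂ, X = ∑ i, c i • P i)
    {ν : Measure (Matrix n n ℂ)} (hν : IsHaar B ν) {U : Matrix n n ℂ}
    (hU : U ∈ unitary (Matrix n n ℂ)) :
    ∫ V, hs2 (U * V - V * U) ∂ν =
      2 * Fintype.card n - 2 * (∑ a, trace (P a * Uᴴ * P a * U)).re := by
  obtain ⟨W, hWB, hW, hWX⟩ := exists_unitary_sum_conj_eq hherm hidem horth hsum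
  refine hν.integral_eq_of_sum_eq (continuous_hs2.comp (by fun_prop)) W
    (fun t => (hB _).2 (hWB t)) hW _ fun V hVB hV => ?_
  have hc (a X) : P a * X * P a * V = V * (P a * X * P a) := by
    obtain ⟨c, rfl⟩ := (hB V).1 hVB
    have hr : P a * ∑ i, c i • P i = c a • P a := by
      rw [Finset.mul_sum, Finset.sum_eq_single a (fun j _ hj => by simp [horth a j hj.symm])
        (by simp), mul_smul_comm, hidem]
    have hl : (∑ i, c i • P i) * P a = c a • P a := by
      rw [Finset.sum_mul, Finset.sum_eq_single a (fun j _ hj => by simp [horth j a hj])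
        (by simp), smul_mul_assoc, hidem]
    rw [mul_assoc, hr, ← mul_assoc _ (P a * X), ← mul_assoc _ (P a), hl, mul_smul_comm,
      smul_mul_assoc, smul_mul_assoc]
  have hVV : Vᴴ * V = 1 := Unitary.star_mul_self_of_mem hV
  have key : ∑ t, trace ((W t * V)ᴴ * Uᴴ * (W t * V) * U) =
      K * ∑ a, trace (P a * Uᴴ * P a * U) := by
    calc _ = trace (Vᴴ * (∑ t, (W t)ᴴ * Uᴴ * W t) * V * U) := by
          simp only [Finset.mul_sum, Finset.sum_mul, trace_sum, conjTranspose_mul, mul_assoc]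
      _ = _ := by
          rw [hWX, mul_smul_comm, smul_mul_assoc, smul_mul_assoc, trace_smul, smul_eq_mul,
            Finset.mul_sum, Finset.sum_mul, Finset.sum_mul, trace_sum]
          refine congrArg _ (Finset.sum_congr rfl fun a _ => ?_)
          rw [mul_assoc Vᴴ, hc, ← mul_assoc Vᴴ, hVV, one_mul]
  simp only [Function.comp_apply]
  rw [Finset.sum_congr rfl fun t _ => hs2_commutator_of_unitary hU (mul_mem (hW t) hV),
    Finset.sum_sub_distrib, ← Finset.mul_sum, ← Finset.mul_sum, ← Complex.re_sum, key]
  simp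
  ring

theorem trace_partialTraceLeft_mul_self {l m : Type*} [Fintype l] [Fintype m]
    {X : Matrix (l × m) (l × m) ℂ} (hX : Xᴴ = X) :
    (trace (partialTraceLeft X * partialTraceLeft X)).re = hs2 (partialTraceLeft X) := by
  rw [hs2, conjTranspose_partialTraceLeft, hX]

theorem continuous_re_trace_conj {n : Type*} [Fintype n] (X : Matrix n n ℂ) :
    Continuous fun U : Matrix n n ℂ => (trace (X * Uᴴ * X * U)).re :=
  Complex.continuous_re.comp (((continuous_const.matrix_mul
    continuous_id.matrix_conjTranspose).matrix_mul continuous_const).matrix_mul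
    continuous_id).matrix_trace

theorem IsHaar.integral_re_trace_conj_of_factor {d : ℕ} [NeZero d] {m : Type*} [Fintype m]
    [DecidableEq m] {A : StarSubalgebra ℂ (Matrix (Fin d × m) (Fin d × m) ℂ)}
    (hA : ∀ X, X ∈ A ↔ ∃ M : Matrix (Fin d) (Fin d) ℂ, X = M ⊗ₖ (1 : Matrix m m ℂ))
    {μ : Measure (Matrix (Fin d × m) (Fin d × m) ℂ)} (hμ : IsHaar A μ)
    {X : Matrix (Fin d × m) (Fin d × m) ℂ} (hX : Xᴴ = X) :
    ∫ U, (trace (X * Uᴴ * X * U)).re ∂μ = hs2 (partialTraceLeft X) / d := by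
  obtain ⟨W, hWA, hW, hWX⟩ := exists_unitary_sum_conj_eq_partialTraceLeft d m
  refine hμ.integral_eq_of_sum_eq (continuous_re_trace_conj X) W (fun k => (hA _).2 (hWA k)) hW _
    fun U hUA hU => ?_
  have hUU : Uᴴ * U = 1 := Unitary.star_mul_self_of_mem hU
  have hc (N : Matrix m m ℂ) :
      ((1 : Matrix (Fin d) (Fin d) ℂ) ⊗ₖ N) * U = U * ((1 : Matrix (Fin d) (Fin d) ℂ) ⊗ₖ N) := by
    obtain ⟨M, rfl⟩ := (hA U).1 hUA
    rw [← mul_kronecker_mul, ← mul_kronecker_mul]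
    simp
  have key : ∑ k, trace (X * (W k * U)ᴴ * X * (W k * U)) =
      d * trace (partialTraceLeft X * partialTraceLeft X) := by
    calc _ = trace (X * Uᴴ * ((∑ k, (W k)ᴴ * X * W k) * U)) := by
          simp only [Finset.mul_sum, Finset.sum_mul, trace_sum, conjTranspose_mul, mul_assoc]
      _ = _ := by
          rw [hWX, smul_mul_assoc, hc, mul_smul_comm, trace_smul, smul_eq_mul,
            mul_assoc, ← mul_assoc Uᴴ, hUU, one_mul, trace_mul_one_kronecker]
  have hd : (d : ℝ) ≠ 0 := NeZero.ne _
  rw [← Complex.re_sum, key, ← Complex.ofReal_natCast, Complex.re_ofReal_mul,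
    trace_partialTraceLeft_mul_self hX]
  simp only [Fintype.card_prod, Fintype.card_fin]
  push_cast
  field_simp

/-- Factor `A = M_{d₁}(ℂ) ⊗ 1` vs abelian `B = span{Π_i}`:
`S(A:B) = 1 - (1/(d d₁)) Σ_i ‖Tr₁ Π_i‖₂²`. -/
theorem stmt_11 (d₁ d₂ : ℕ) (h₁ : 0 < d₁) (h₂ : 0 < d₂) (K : ℕ)
    (Pr : Fin K → Matrix (Fin d₁ × Fin d₂) (Fin d₁ × Fin d₂) ℂ)
    (hherm : ∀ i, (Pr i)ᴴ = Pr i) (hidem : ∀ i, Pr i * Pr i = Pr i)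
    (horth : ∀ i j, i ≠ j → Pr i * Pr j = 0) (hsum : ∑ i, Pr i = 1)
    (A B : StarSubalgebra ℂ (Matrix (Fin d₁ × Fin d₂) (Fin d₁ × Fin d₂) ℂ))
    (hA : (A : Set (Matrix (Fin d₁ × Fin d₂) (Fin d₁ × Fin d₂) ℂ)) =
      {X | ∃ M : Matrix (Fin d₁) (Fin d₁) ℂ, X = M ⊗ₖ (1 : Matrix (Fin d₂) (Fin d₂) ℂ)})
    (hB : (B : Set (Matrix (Fin d₁ × Fin d₂) (Fin d₁ × Fin d₂) ℂ)) =
      {X | ∃ c : Fin K → ℂ, X = ∑ i, c i • Pr i})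
    (μ ν : Measure (Matrix (Fin d₁ × Fin d₂) (Fin d₁ × Fin d₂) ℂ))
    (hμ : IsHaar A μ) (hν : IsHaar B ν) :
    MAN μ ν = 1 - (1 / (((d₁ * d₂ : ℕ) : ℝ) * (d₁ : ℝ))) *
      ∑ i, hs2 (Matrix.of fun j j' : Fin d₂ => ∑ a : Fin d₁, Pr i (a, j) (a, j')) := by
  have : NeZero d₁ := ⟨h₁.ne'⟩
  have : NeZero K := ⟨by
    rintro rfl
    have := congrFun (congrFun hsum (⟨0, h₁⟩, ⟨0, h₂⟩)) (⟨0, h₁⟩, ⟨0, h₂⟩)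
    simp at this⟩
  have hprob := hμ.1
  have hcont (a : Fin K) : Continuous fun U : Matrix (Fin d₁ × Fin d₂) (Fin d₁ × Fin d₂) ℂ =>
      (trace (Pr a * Uᴴ * Pr a * U)).re := continuous_re_trace_conj _
  have hint : ∫ U, ∫ V, hs2 (U * V - V * U) ∂ν ∂μ =
      2 * (d₁ * d₂ : ℕ) - 2 * ∑ a, hs2 (partialTraceLeft (Pr a)) / d₁ := by
    rw [integral_congr_ae (hμ.ae_mem_s11.mono fun U hU =>
      hν.integral_hs2_commutator_of_span hherm hidem horth hsum (Set.ext_iff.1 hB) hU.2)]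
    simp only [Complex.re_sum]
    rw [integral_sub (integrable_const _)
      ((integrable_finsetSum _ fun a _ => hμ.integrable (hcont a)).const_mul _),
      integral_const, integral_const_mul, integral_finsetSum _ fun a _ => hμ.integrable (hcont a)]
    simp only [hμ.integral_re_trace_conj_of_factor (Set.ext_iff.1 hA) (hherm _)]
    simp
  have hd₁ : (d₁ : ℝ) ≠ 0 := by exact_mod_cast h₁.ne'
  have hd₂ : (d₂ : ℝ) ≠ 0 := by exact_mod_cast h₂.ne'
  rw [MAN, hint, ← Finset.sum_div]
  simp only [partialTraceLeft, Fintype.card_prod, Fintype.card_fin]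
  push_cast
  field_simp
end
end
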